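/- An invertible bounded linear operator T on a Hilbert space is quasi-hyperbolic if and only if its approximate point spectrum does not meet the unit circle: σ_ap(T) ∩ 𝕋 = ∅. -/

import Mathlib

set_option synthInstance.maxHeartbeats 1000000

/-- The approximate point spectrum of a bounded operator: `μ` such that there exist
unit vectors `x n` with `‖(T - μ) x n‖ → 0`. -/
def approxPointSpectrum {H : Type*} [NormedAddCommGroup H] [InnerProductSpace ℂ H]
    [CompleteSpace H] (T : H →L[ℂ] H) : Set ℂ :=
  {μ | ∃ x : ℕ → H, (∀ n, ‖x n‖ = 1) ∧
    Filter.Tendsto (fun n => ‖T (x n) - μ • x n‖) Filter.atTop (nhds 0)}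

/-- `T` is quasi-hyperbolic if for some `n`, `max (‖T^{2n} x‖, ‖x‖) ≥ 2‖T^n x‖` for all `x`. -/
def QuasiHyperbolic {H : Type*} [NormedAddCommGroup H] [InnerProductSpace ℂ H]
    [CompleteSpace H] (T : H →L[ℂ] H) : Prop :=
  ∃ n : ℕ, ∀ x : H, 2 * ‖(T ^ n) x‖ ≤ max ‖(T ^ (2 * n)) x‖ ‖x‖

open Finset in
/-- Parseval's identity for the discrete Fourier transform of a finite sequence of vectors. -/
theorem IsPrimitiveRoot.sum_norm_sq_sum_pow_smul {H : Type*} [NormedAddCommGroup H]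
    [InnerProductSpace ℂ H] {N : ℕ} {ζ : ℂ} (hζ : IsPrimitiveRoot ζ N) (hN : N ≠ 0)
    (v : ℕ → H) :
    ∑ j ∈ range N, ‖∑ k ∈ range N, (ζ ^ j) ^ k • v k‖ ^ 2 =
      N * ∑ k ∈ range N, ‖v k‖ ^ 2 := by
  have hnorm : ‖ζ‖ = 1 := hζ.norm'_eq_one hN
  have hζ0 : ζ ≠ 0 := hζ.ne_zero hN
  have hconj : (starRingEnd ℂ) ζ = ζ⁻¹ := (Complex.inv_eq_conj hnorm).symm
  have horth : ∀ k ∈ range N, ∀ l ∈ range N,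
      ∑ j ∈ range N, (starRingEnd ℂ) ((ζ ^ j) ^ k) * (ζ ^ j) ^ l =
        if k = l then (N : ℂ) else 0 := by
    intro k hk l hl
    have hterm : ∀ j, (starRingEnd ℂ) ((ζ ^ j) ^ k) * (ζ ^ j) ^ l = ((ζ ^ k)⁻¹ * ζ ^ l) ^ j := by
      intro j
      rw [map_pow, map_pow, hconj, mul_pow, inv_pow, inv_pow, inv_pow, ← pow_mul, ← pow_mul,
        ← pow_mul, ← pow_mul, mul_comm j k, mul_comm j l]
    simp_rw [hterm]
    split_ifs with h
    · subst h
      simp [hζ0]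
    · have hne : (ζ ^ k)⁻¹ * ζ ^ l ≠ 1 := by
        intro he
        rw [inv_mul_eq_one₀ (pow_ne_zero _ hζ0)] at he
        exact h (hζ.pow_inj (mem_range.1 hk) (mem_range.1 hl) he)
      rw [geom_sum_eq hne, mul_pow, inv_pow, ← pow_mul, ← pow_mul, mul_comm k, mul_comm l,
        pow_mul, pow_mul, hζ.pow_eq_one]
      simp
  have hcomplex : ((∑ j ∈ range N, ‖∑ k ∈ range N, (ζ ^ j) ^ k • v k‖ ^ 2 : ℝ) : ℂ) =
      ((N * ∑ k ∈ range N, ‖v k‖ ^ 2 : ℝ) : ℂ) := by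
    push_cast
    have hinner : ∀ j, (‖∑ k ∈ range N, (ζ ^ j) ^ k • v k‖ : ℂ) ^ 2 =
        ∑ k ∈ range N, ∑ l ∈ range N,
          (starRingEnd ℂ) ((ζ ^ j) ^ k) * (ζ ^ j) ^ l * inner ℂ (v k) (v l) := by
      intro j
      have h := inner_self_eq_norm_sq_to_K (𝕜 := ℂ) (∑ k ∈ range N, (ζ ^ j) ^ k • v k)
      refine h.symm.trans ?_
      rw [sum_inner]
      refine sum_congr rfl fun k _ => ?_
      rw [inner_sum]
      refine sum_congr rfl fun l _ => ?_
      rw [inner_smul_left, inner_smul_right, mul_assoc]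
    simp_rw [hinner]
    rw [sum_comm, mul_sum]
    refine sum_congr rfl fun k hk => ?_
    rw [sum_comm]
    calc _ = ∑ l ∈ range N, (if k = l then (N : ℂ) else 0) * inner ℂ (v k) (v l) := by
          refine sum_congr rfl fun l hl => ?_
          rw [← sum_mul, horth k hk l hl]
      _ = _ := by
          have h := inner_self_eq_norm_sq_to_K (𝕜 := ℂ) (v k)
          simp only [ite_mul, zero_mul, sum_ite_eq, if_pos hk, h]
          rfl
  exact_mod_cast hcomplex

section BoundedBelow

variable {H : Type*} [NormedAddCommGroup H] [InnerProductSpace ℂ H] {T : H →L[ℂ] H}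

/-- If the approximate point spectrum misses the unit circle, then `T - μ` is bounded below
uniformly in `μ` on the circle. -/
theorem exists_bound_of_approxPointSpectrum_inter_circle_eq_empty [CompleteSpace H]
    (hT : approxPointSpectrum T ∩ {z : ℂ | ‖z‖ = 1} = ∅) :
    ∃ c : ℝ, 0 < c ∧ ∀ μ : ℂ, ‖μ‖ = 1 → ∀ y : H, c * ‖y‖ ≤ ‖T y - μ • y‖ := by
  by_contra! hcon
  choose μ hμ y hy using fun n : ℕ => hcon (1 / ((n : ℝ) + 1)) Nat.one_div_pos_of_nat
  obtain ⟨l, hl, φ, hφ, hlim⟩ := (isCompact_sphere (0 : ℂ) 1).tendsto_subseq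
    (x := μ) fun n => by simpa using hμ n
  have hy0 : ∀ n, ‖y n‖ ≠ 0 := by
    intro n h
    have h' := hy n
    rw [norm_eq_zero.1 h] at h'
    simp at h'
  let x : ℕ → H := fun n => ((‖y n‖⁻¹ : ℝ) : ℂ) • y n
  have hx : ∀ n, ‖x n‖ = 1 := fun n => by simp [x, norm_smul, hy0 n]
  have hxT : ∀ n, ‖T (x n) - μ n • x n‖ ≤ 1 / ((n : ℝ) + 1) := by
    intro n
    have he : T (x n) - μ n • x n = ((‖y n‖⁻¹ : ℝ) : ℂ) • (T (y n) - μ n • y n) := by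
      simp only [x, map_smul, smul_sub]
      rw [smul_comm]
    rw [he, norm_smul, Complex.norm_real, norm_inv, norm_norm,
      inv_mul_le_iff₀ (lt_of_le_of_ne (norm_nonneg _) (hy0 n).symm), mul_comm]
    exact (hy n).le
  refine Set.notMem_empty l (hT ▸ ⟨⟨x ∘ φ, fun n => hx _, ?_⟩, by simpa using hl⟩)
  have hbound : Filter.Tendsto (fun n => 1 / ((φ n : ℝ) + 1) + ‖μ (φ n) - l‖)
      Filter.atTop (nhds 0) := by
    simpa using (tendsto_one_div_add_atTop_nhds_zero_nat.comp hφ.tendsto_atTop).add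
      (tendsto_iff_norm_sub_tendsto_zero.1 hlim)
  refine squeeze_zero (fun n => norm_nonneg _) (fun n => ?_) hbound
  have he : T (x (φ n)) - l • x (φ n) =
      (T (x (φ n)) - μ (φ n) • x (φ n)) + (μ (φ n) - l) • x (φ n) := by
    rw [sub_smul]
    abel
  calc ‖T (x (φ n)) - l • x (φ n)‖
      ≤ ‖T (x (φ n)) - μ (φ n) • x (φ n)‖ + ‖(μ (φ n) - l) • x (φ n)‖ := by
        rw [he]
        exact norm_add_le _ _
    _ ≤ _ := by
        rw [norm_smul, hx, mul_one]
        gcongr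
        exact hxT _

open Finset in
/-- A uniform lower bound for `T - μ` on the unit circle yields a weighted `ℓ²` inequality
along orbits of `T`. -/
theorem sq_mul_sum_weight_sq_mul_norm_sq_le {c : ℝ} (hc : 0 ≤ c)
    (hT : ∀ μ : ℂ, ‖μ‖ = 1 → ∀ y : H, c * ‖y‖ ≤ ‖T y - μ • y‖)
    (m : ℕ) (W : ℕ → ℝ) (hW0 : W 0 = 0) (hWm : W (m + 1) = 0) (x : H) :
    c ^ 2 * ∑ k ∈ range (m + 1), W (k + 1) ^ 2 * ‖(T ^ k) x‖ ^ 2 ≤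
      ∑ k ∈ range (m + 1), (W k - W (k + 1)) ^ 2 * ‖(T ^ k) x‖ ^ 2 := by
  have hζ := Complex.isPrimitiveRoot_exp (m + 1) m.succ_ne_zero
  set ζ := Complex.exp (2 * Real.pi * Complex.I / ((m + 1 : ℕ) : ℂ))
  have hnorm : ‖ζ‖ = 1 := hζ.norm'_eq_one m.succ_ne_zero
  have hpoint : ∀ μ : ℂ, ‖μ‖ = 1 →
      c ^ 2 * ‖∑ k ∈ range (m + 1), μ ^ k • ((W (k + 1) : ℂ) • (T ^ k) x)‖ ^ 2 ≤
        ‖∑ k ∈ range (m + 1), μ ^ k • (((W k - W (k + 1) : ℝ) : ℂ) • (T ^ k) x)‖ ^ 2 := by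
    intro μ hμ
    have hμ0 : μ ≠ 0 := by
      rintro rfl
      simp at hμ
    set y := ∑ k ∈ range (m + 1), μ ^ k • ((W (k + 1) : ℂ) • (T ^ k) x) with hy
    have hshift : μ • T y = ∑ k ∈ range (m + 1), μ ^ k • ((W k : ℂ) • (T ^ k) x) := by
      rw [sum_range_succ', hy, sum_range_succ, hW0, hWm]
      simp only [Complex.ofReal_zero, zero_smul, smul_zero, add_zero, map_sum, map_smul, smul_sum]
      refine sum_congr rfl fun k _ => ?_
      rw [smul_smul, ← pow_succ', pow_succ' T k, mul_apply_eq_comp]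
    have hdiff : ∑ k ∈ range (m + 1), μ ^ k • (((W k - W (k + 1) : ℝ) : ℂ) • (T ^ k) x) =
        μ • (T y - μ⁻¹ • y) := by
      rw [smul_sub, smul_smul, mul_inv_cancel₀ hμ0, one_smul, hshift, hy, ← sum_sub_distrib]
      refine sum_congr rfl fun k _ => ?_
      rw [Complex.ofReal_sub, sub_smul, smul_sub]
    rw [hdiff, norm_smul, hμ, one_mul, ← mul_pow]
    exact pow_le_pow_left₀ (by positivity) (hT _ (by rw [norm_inv, hμ, inv_one]) y) 2
  have hsum := sum_le_sum fun j (_ : j ∈ range (m + 1)) =>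
    hpoint (ζ ^ j) (by rw [norm_pow, hnorm, one_pow])
  rw [← mul_sum, hζ.sum_norm_sq_sum_pow_smul m.succ_ne_zero,
    hζ.sum_norm_sq_sum_pow_smul m.succ_ne_zero] at hsum
  simp only [norm_smul, mul_pow, Complex.norm_real, Real.norm_eq_abs, sq_abs] at hsum
  refine le_of_mul_le_mul_left ?_ (Nat.cast_pos.2 m.succ_pos : (0 : ℝ) < ((m + 1 : ℕ) : ℝ))
  linarith

open Finset in
/-- The tent-shaped weight `q ^ min k (2 * n - k)` turns the weighted inequality into a convexity
estimate with geometric gain at the midpoint of an orbit segment. -/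
theorem pow_mul_norm_sq_le_of_bound {c : ℝ} (hc : 0 < c)
    (hT : ∀ μ : ℂ, ‖μ‖ = 1 → ∀ y : H, c * ‖y‖ ≤ ‖T y - μ • y‖)
    {n : ℕ} (hn : n ≠ 0) (x : H) :
    3 / 4 * c ^ 2 * ((1 + c / 2) ^ n) ^ 2 * ‖(T ^ n) x‖ ^ 2 ≤
      ‖x‖ ^ 2 + (1 + c / 2) ^ 2 * ‖(T ^ (2 * n)) x‖ ^ 2 := by
  set q := 1 + c / 2 with hq
  have hq0 : 0 < q := by positivity
  obtain ⟨p, hp⟩ : ∃ p, 2 * n = p + 1 := ⟨2 * n - 1, by omega⟩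
  let W : ℕ → ℝ := fun k => if k = 0 ∨ 2 * n < k then 0 else q ^ min (k - 1) (2 * n + 1 - k)
  have hmain := sq_mul_sum_weight_sq_mul_norm_sq_le hc.le hT (2 * n) W (by simp [W])
    (by simp [W]) x
  have hWlast : W (2 * n) = q := by
    have h1 : ¬ (2 * n = 0 ∨ 2 * n < 2 * n) := by omega
    have h2 : min (2 * n - 1) (2 * n + 1 - 2 * n) = 1 := by omega
    simp only [W, if_neg h1, h2, pow_one]
  have hWend : W (2 * n + 1) = 0 := by simp [W]
  have hWfirst : W 1 = 1 := by
    have h1 : ¬ (1 = 0 ∨ 2 * n < 1) := by omega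
    simp only [W, if_neg h1]
    simp
  have hWmid : W (n + 1) = q ^ n := by
    have h1 : ¬ (n + 1 = 0 ∨ 2 * n < n + 1) := by omega
    have h2 : min (n + 1 - 1) (2 * n + 1 - (n + 1)) = n := by omega
    simp only [W, if_neg h1, h2]
  have hstep : ∀ k ∈ range p, (W (k + 1) - W (k + 2)) ^ 2 ≤ c ^ 2 / 4 * W (k + 2) ^ 2 := by
    intro k hk
    rw [mem_range] at hk
    have h1 : ¬ (k + 1 = 0 ∨ 2 * n < k + 1) := by omega
    have h2 : ¬ (k + 2 = 0 ∨ 2 * n < k + 2) := by omega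
    simp only [W, if_neg h1, if_neg h2]
    rcases le_or_gt (k + 1) n with h | h
    · have e1 : min (k + 1 - 1) (2 * n + 1 - (k + 1)) = k := by omega
      have e2 : min (k + 2 - 1) (2 * n + 1 - (k + 2)) = k + 1 := by omega
      rw [e1, e2]
      have e3 : (q ^ k - q ^ (k + 1)) ^ 2 = c ^ 2 / 4 * (q ^ k) ^ 2 := by
        rw [pow_succ q k, hq]
        ring
      rw [e3]
      gcongr
      · rw [hq]
        linarith
      · omega
    · obtain ⟨i, hi⟩ : ∃ i, i + k + 1 = 2 * n := ⟨2 * n - (k + 1), by omega⟩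
      have e1 : min (k + 1 - 1) (2 * n + 1 - (k + 1)) = i + 1 := by omega
      have e2 : min (k + 2 - 1) (2 * n + 1 - (k + 2)) = i := by omega
      rw [e1, e2, pow_succ q i, hq]
      exact le_of_eq (by ring)
  have hmem : n - 1 ∈ range p := by
    rw [mem_range]
    omega
  have hsingle := single_le_sum (f := fun k => W (k + 2) ^ 2 * ‖(T ^ (k + 1)) x‖ ^ 2)
    (fun k _ => by positivity) hmem
  have e1 : n - 1 + 2 = n + 1 := by omega
  have e2 : n - 1 + 1 = n := by omega
  simp only [e1, e2, hWmid] at hsingle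
  have hinterior : ∑ k ∈ range p, (W (k + 1) - W (k + 2)) ^ 2 * ‖(T ^ (k + 1)) x‖ ^ 2 ≤
      c ^ 2 / 4 * ∑ k ∈ range p, W (k + 2) ^ 2 * ‖(T ^ (k + 1)) x‖ ^ 2 := by
    rw [mul_sum]
    refine sum_le_sum fun k hk => ?_
    rw [← mul_assoc]
    exact mul_le_mul_of_nonneg_right (hstep k hk) (by positivity)
  rw [sum_range_succ, sum_range_succ, hWend, hWlast, hp, sum_range_succ', sum_range_succ'] at hmain
  simp only [add_assoc, one_add_one_eq_two, zero_add, hWfirst, pow_zero,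
    one_apply_eq_self] at hmain
  rw [show W 0 = 0 by simp [W]] at hmain
  rw [hp]
  set S := ∑ k ∈ range p, W (k + 2) ^ 2 * ‖(T ^ (k + 1)) x‖ ^ 2
  have hprod := mul_le_mul_of_nonneg_left hsingle (by positivity : 0 ≤ 3 / 4 * c ^ 2)
  have hx0 : 0 ≤ c ^ 2 * ‖x‖ ^ 2 := by positivity
  nlinarith [hmain, hinterior, hprod, hx0]

/-- A uniform lower bound for `T - μ` on the unit circle forces quasi-hyperbolicity. -/
theorem quasiHyperbolic_of_bound [CompleteSpace H] {c : ℝ} (hc : 0 < c)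
    (hT : ∀ μ : ℂ, ‖μ‖ = 1 → ∀ y : H, c * ‖y‖ ≤ ‖T y - μ • y‖) : QuasiHyperbolic T := by
  set q := 1 + c / 2 with hq
  have hq1 : 1 < q := by
    rw [hq]
    linarith
  obtain ⟨n, hn⟩ := pow_unbounded_of_one_lt (4 * (1 + q ^ 2) / (3 / 4 * c ^ 2)) hq1
  rw [div_lt_iff₀ (by positivity)] at hn
  refine ⟨n + 1, fun x => ?_⟩
  have hest := pow_mul_norm_sq_le_of_bound hc hT n.succ_ne_zero x
  rw [← hq] at hest
  have hpow : q ^ n ≤ (q ^ (n + 1)) ^ 2 := by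
    rw [← pow_mul]
    exact pow_le_pow_right₀ hq1.le (by omega)
  set M := max ‖(T ^ (2 * (n + 1))) x‖ ‖x‖
  have hM0 : 0 ≤ M := le_max_of_le_right (norm_nonneg _)
  have hM1 : ‖(T ^ (2 * (n + 1))) x‖ ^ 2 ≤ M ^ 2 :=
    pow_le_pow_left₀ (norm_nonneg _) (le_max_left _ _) 2
  have hM2 : ‖x‖ ^ 2 ≤ M ^ 2 := pow_le_pow_left₀ (norm_nonneg _) (le_max_right _ _) 2
  have hcoef : 4 * (1 + q ^ 2) ≤ 3 / 4 * c ^ 2 * (q ^ (n + 1)) ^ 2 := by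
    have := mul_le_mul_of_nonneg_left hpow (by positivity : 0 ≤ 3 / 4 * c ^ 2)
    linarith
  refine le_of_sq_le_sq ?_ hM0
  refine le_of_mul_le_mul_left ?_ (by positivity : 0 < 1 + q ^ 2)
  calc (1 + q ^ 2) * (2 * ‖(T ^ (n + 1)) x‖) ^ 2
      = 4 * (1 + q ^ 2) * ‖(T ^ (n + 1)) x‖ ^ 2 := by ring
    _ ≤ 3 / 4 * c ^ 2 * (q ^ (n + 1)) ^ 2 * ‖(T ^ (n + 1)) x‖ ^ 2 := by gcongr
    _ ≤ ‖x‖ ^ 2 + q ^ 2 * ‖(T ^ (2 * (n + 1))) x‖ ^ 2 := hest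
    _ ≤ M ^ 2 + q ^ 2 * M ^ 2 := by gcongr
    _ = (1 + q ^ 2) * M ^ 2 := by ring

/-- Approximate eigenvectors for `μ` are approximate eigenvectors of `T ^ m` for `μ ^ m`. -/
theorem tendsto_pow_apply_sub_pow_smul {x : ℕ → H} {μ : ℂ}
    (hx : Filter.Tendsto (fun k => T (x k) - μ • x k) Filter.atTop (nhds 0)) (m : ℕ) :
    Filter.Tendsto (fun k => (T ^ m) (x k) - μ ^ m • x k) Filter.atTop (nhds 0) := by
  induction m with
  | zero => simp
  | succ m ih =>
    have h := ((T.continuous.tendsto 0).comp ih).add (hx.const_smul (μ ^ m))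
    rw [map_zero, smul_zero, add_zero] at h
    refine h.congr fun k => ?_
    simp only [Function.comp_apply, map_sub, map_smul, smul_sub, smul_smul, ← pow_succ]
    rw [pow_succ' T m, mul_apply_eq_comp]
    abel

/-- Powers of `T` asymptotically preserve the norm of unit approximate eigenvectors for a
unimodular `μ`. -/
theorem tendsto_norm_pow_apply {x : ℕ → H} {μ : ℂ} (hμ : ‖μ‖ = 1) (hx1 : ∀ k, ‖x k‖ = 1)
    (hx : Filter.Tendsto (fun k => T (x k) - μ • x k) Filter.atTop (nhds 0)) (m : ℕ) :
    Filter.Tendsto (fun k => ‖(T ^ m) (x k)‖) Filter.atTop (nhds 1) := by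
  rw [tendsto_iff_norm_sub_tendsto_zero]
  refine squeeze_zero (fun k => norm_nonneg _) (fun k => ?_)
    (tendsto_zero_iff_norm_tendsto_zero.1 (tendsto_pow_apply_sub_pow_smul hx m))
  have h := abs_norm_sub_norm_le ((T ^ m) (x k)) (μ ^ m • x k)
  rwa [norm_smul, norm_pow, hμ, one_pow, hx1, one_mul] at h

theorem QuasiHyperbolic.approxPointSpectrum_inter_circle_eq_empty [CompleteSpace H]
    (hT : QuasiHyperbolic T) :
    approxPointSpectrum T ∩ {z : ℂ | ‖z‖ = 1} = ∅ := by
  obtain ⟨n, hn⟩ := hT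
  rw [Set.eq_empty_iff_forall_notMem]
  rintro μ ⟨⟨x, hx1, hx⟩, hμ⟩
  have hlim := tendsto_norm_pow_apply hμ hx1 (tendsto_zero_iff_norm_tendsto_zero.2 hx)
  have h := le_of_tendsto_of_tendsto' ((hlim n).const_mul 2)
    ((hlim (2 * n)).max (hlim 0)) fun k => by simpa using hn (x k)
  norm_num at h

end BoundedBelow

/-- An invertible bounded operator `T` is quasi-hyperbolic iff its approximate point
spectrum does not meet the unit circle. -/
theorem quasiHyperbolic_iff_approxPointSpectrum {H : Type*} [NormedAddCommGroup H]
    [InnerProductSpace ℂ H] [CompleteSpace H] (T : H →L[ℂ] H) (hinv : IsUnit T) :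
    QuasiHyperbolic T ↔ approxPointSpectrum T ∩ {z : ℂ | ‖z‖ = 1} = ∅ := by
  exact ⟨fun h => h.approxPointSpectrum_inter_circle_eq_empty, fun h =>
    let ⟨_, hc, hT⟩ := exists_bound_of_approxPointSpectrum_inter_circle_eq_empty h
    quasiHyperbolic_of_bound hc hT⟩
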